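/- arXiv:math-ph/0611030 — 4 statements merged into one kernel-verified Lean document; each statement's English description precedes it below -/
import Mathlib

section
/- (Braided reflection equation by Baxterisation.) Let A be an associative unital ℂ-algebra, q, w ∈ ℂ∖{0} with a fixed square root w^{1/2}, ε' ∈ {1,−1}, η ∈ {1,−1}, and let σ, ρ, b ∈ A be invertible elements satisfying: σ − σ⁻¹ = q − q⁻¹; ρ(ρ − ρ⁻¹) = ε'w²(ρ − ρ⁻¹); σbρ⁻¹b = bρ⁻¹bσ; ρbσb = bσbρ; σbρb − σb⁻¹ρ⁻¹b⁻¹ = bρbσ − b⁻¹ρ⁻¹b⁻¹σ; σb⁻¹ρb − σ⁻¹bρb⁻¹ = bρb⁻¹σ − b⁻¹ρbσ⁻¹; σb⁻¹ρ⁻¹b − σ⁻¹bρ⁻¹b⁻¹ = bρ⁻¹b⁻¹σ − b⁻¹ρ⁻¹bσ⁻¹; and the quotient relation (b + √(ε')·w⁻¹)(b + b⁻¹) = 0, where √1 = 1 and √(−1) = i. Define r̂(λ) := e^λσ − e^{−λ}σ⁻¹, r̃(λ) := w⁻¹e^{−λ}ρ − w·e^λρ⁻¹, and k(λ) := e^λ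 w^{1/2} b + η e^{−λ} w^{−1/2} b⁻¹. Then for all λ₁, λ₂ ∈ ℂ: r̂(λ₁−λ₂) k(λ₁) r̃(λ₁+λ₂) k(λ₂) = k(λ₂) r̃(λ₁+λ₂) k(λ₁) r̂(λ₁−λ₂). -/
theorem commute_inverse_left {M : Type*} [Monoid M] {a ai x : M}
    (h : a * ai = 1) (h' : ai * a = 1) (hx : a * x = x * a) : ai * x = x * ai :=
  (Commute.units_inv_left (u := ⟨a, ai, h, h'⟩) hx).eq

/-- The braided reflection equation for two-term elements with general coefficients: only
two relations between the coefficients matter. -/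
theorem braided_reflection_of_coeff {R A : Type*} [CommRing R] [Ring A] [Algebra R A]
    {σ ρ b σi ρi bi : A} {κ p p' a a' c c' d d' : R}
    (hs : σ * σi = 1) (hs' : σi * σ = 1)
    (hr : ρ * ρi = 1) (hr' : ρi * ρ = 1)
    (hb : b * bi = 1) (hb' : bi * b = 1)
    (hH : σ - σi = κ • (1 : A))
    (hb1 : σ * b * ρi * b = b * ρi * b * σ)
    (hb2 : ρ * b * σ * b = b * σ * b * ρ)
    (hb3 : σ * b * ρ * b - σ * bi * ρi * bi = b * ρ * b * σ - bi * ρi * bi * σ)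
    (hb4 : σ * bi * ρ * b - σi * b * ρ * bi = b * ρ * bi * σ - bi * ρ * b * σi)
    (hb5 : σ * bi * ρi * b - σi * b * ρi * bi = b * ρi * bi * σ - bi * ρi * b * σi)
    (hbb : a * c * d = a' * c' * d') (hmix : p' * a * d' = p * a' * d) :
    (p • σ - p' • σi) * (a • b + a' • bi) * (c • ρ - c' • ρi) * (d • b + d' • bi) =
      (d • b + d' • bi) * (c • ρ - c' • ρi) * (a • b + a' • bi) * (p • σ - p' • σi) := by
  have cancel_b (x : A) : b * (bi * x) = x := by rw [← mul_assoc, hb, one_mul]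
  have cancel_bi (x : A) : bi * (b * x) = x := by rw [← mul_assoc, hb', one_mul]
  have cancel_r (x : A) : ρ * (ρi * x) = x := by rw [← mul_assoc, hr, one_mul]
  have cancel_ri (x : A) : ρi * (ρ * x) = x := by rw [← mul_assoc, hr', one_mul]
  have cancel_s (x : A) : σ * (σi * x) = x := by rw [← mul_assoc, hs, one_mul]
  have cancel_si (x : A) : σi * (σ * x) = x := by rw [← mul_assoc, hs', one_mul]
  have hb3i : σi * b * ρ * b - σi * bi * ρi * bi = b * ρ * b * σi - bi * ρi * bi * σi := by
    obtain rfl : σi = σ - κ • (1 : A) := by rw [← hH]; abel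
    simp only [sub_mul, mul_sub, smul_mul_assoc, mul_smul_comm, one_mul, mul_one]
    linear_combination (norm := module) hb3
  simp only [mul_assoc] at hb1 hb2 hb3 hb4 hb5 hb3i
  have u : (b * (ρi * b)) * (bi * (ρ * bi)) = 1 := by
    simp only [mul_assoc, cancel_b, cancel_ri, hb]
  have u' : (bi * (ρ * bi)) * (b * (ρi * b)) = 1 := by
    simp only [mul_assoc, cancel_bi, cancel_r, hb']
  have v : (b * (σ * b)) * (bi * (σi * bi)) = 1 := by
    simp only [mul_assoc, cancel_b, cancel_s, hb]
  have v' : (bi * (σi * bi)) * (b * (σ * b)) = 1 := by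
    simp only [mul_assoc, cancel_bi, cancel_si, hb']
  have w1 : b * (ρi * b) * σ = σ * (b * (ρi * b)) := by simp only [mul_assoc, hb1]
  have w2 : ρ * (b * (σ * b)) = b * (σ * b) * ρ := by simp only [mul_assoc, hb2]
  have e1 := commute_inverse_left hs hs' w1.symm
  have e2 := commute_inverse_left u u' w1
  have e3 := commute_inverse_left u u' e1.symm
  have f1 := commute_inverse_left hr hr' w2
  have f2 := commute_inverse_left v v' w2.symm
  have f3 := commute_inverse_left v v' f1.symm
  have g0 := congrArg (fun x => bi * (x * bi)) w2
  have g1 := congrArg (fun x => bi * (x * bi)) f1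
  have g2 := congrArg (fun x => b * (x * b)) f2
  have g3 := congrArg (fun x => b * (x * b)) f3
  simp only [mul_assoc, cancel_b, cancel_bi, hb, hb', mul_one] at e1 e2 e3 g0 g1 g2 g3
  simp only [sub_mul, mul_sub, add_mul, mul_add, smul_mul_assoc, mul_smul_comm, mul_assoc]
  linear_combination (norm := module) (p * a * c * d) • hb3 - (p' * a * c * d) • hb3i
    + hbb • (p • (σ * (bi * (ρi * bi)) - bi * (ρi * (bi * σ)))
        - p' • (σi * (bi * (ρi * bi)) - bi * (ρi * (bi * σi))))
    + (p * a' * c * d) • hb4 - (p * a' * c' * d) • hb5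
    - hmix • (c • (σi * (b * (ρ * bi)) - bi * (ρ * (b * σi)))
        - c' • (σi * (b * (ρi * bi)) - bi * (ρi * (b * σi))))
    - (p * a * c' * d) • hb1 + (p' * a * c' * d) • e1
    - (p * a' * c * d') • e2 + (p' * a' * c * d') • e3
    - (p * a * c * d') • g0 + (p * a * c' * d') • g1
    - (p' * a' * c * d) • g2 + (p' * a' * c' * d) • g3

/-- braided reflection equation by Baxterisation: in the quotient algebra
`N¹_N(w,±,q)`, the Baxterised elements `r̂(λ) = e^λσ − e^{−λ}σ⁻¹`,
`r̃(λ) = w⁻¹e^{−λ}ρ − we^λρ⁻¹` and `k(λ) = e^λ w^{1/2} b + η e^{−λ} w^{−1/2} b⁻¹`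
satisfy the braided reflection equation. -/
theorem statement15 (A : Type*) [Ring A] [Algebra ℂ A]
    (q w ws : ℂ) (hq : q ≠ 0) (hw : w ≠ 0) (hws : ws ^ 2 = w)
    (ε' : ℂ) (hε' : ε' = 1 ∨ ε' = -1) (η : ℂ) (hη : η = 1 ∨ η = -1)
    (sq : ℂ) (hsq : (ε' = 1 ∧ sq = 1) ∨ (ε' = -1 ∧ sq = Complex.I))
    (σ ρ b σi ρi bi : A)
    (hs : σ * σi = 1) (hs' : σi * σ = 1)
    (hr : ρ * ρi = 1) (hr' : ρi * ρ = 1)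
    (hb : b * bi = 1) (hb' : bi * b = 1)
    (hH : σ - σi = (q - q⁻¹) • (1 : A))
    (hrho : ρ * (ρ - ρi) = (ε' * w ^ 2) • (ρ - ρi))
    (hb1 : σ * b * ρi * b = b * ρi * b * σ)
    (hb2 : ρ * b * σ * b = b * σ * b * ρ)
    (hb3 : σ * b * ρ * b - σ * bi * ρi * bi = b * ρ * b * σ - bi * ρi * bi * σ)
    (hb4 : σ * bi * ρ * b - σi * b * ρ * bi = b * ρ * bi * σ - bi * ρ * b * σi)
    (hb5 : σ * bi * ρi * b - σi * b * ρi * bi = b * ρi * bi * σ - bi * ρi * b * σi)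
    (hquot : (b + (sq * w⁻¹) • (1 : A)) * (b + bi) = 0)
    (l1 l2 : ℂ) :
    (Complex.exp (l1 - l2) • σ - Complex.exp (-(l1 - l2)) • σi) *
        ((Complex.exp l1 * ws) • b + (η * Complex.exp (-l1) * ws⁻¹) • bi) *
        ((w⁻¹ * Complex.exp (-(l1 + l2))) • ρ - (w * Complex.exp (l1 + l2)) • ρi) *
        ((Complex.exp l2 * ws) • b + (η * Complex.exp (-l2) * ws⁻¹) • bi) =
      ((Complex.exp l2 * ws) • b + (η * Complex.exp (-l2) * ws⁻¹) • bi) *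
        ((w⁻¹ * Complex.exp (-(l1 + l2))) • ρ - (w * Complex.exp (l1 + l2)) • ρi) *
        ((Complex.exp l1 * ws) • b + (η * Complex.exp (-l1) * ws⁻¹) • bi) *
        (Complex.exp (l1 - l2) • σ - Complex.exp (-(l1 - l2)) • σi) := by
  have hws0 : ws ≠ 0 := by
    rintro rfl
    exact hw (by simpa using hws.symm)
  have hη2 : η ^ 2 = 1 := by rcases hη with rfl | rfl <;> norm_num
  have hx := Complex.exp_ne_zero l1
  have hy := Complex.exp_ne_zero l2
  refine braided_reflection_of_coeff hs hs' hr hr' hb hb' hH hb1 hb2 hb3 hb4 hb5 ?_ ?_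
  · subst hws
    simp only [Complex.exp_add, Complex.exp_neg]
    field_simp
    simp [hη2]
  · simp only [Complex.exp_sub, Complex.exp_neg]
    field_simp
end

section
/- Let A be an associative unital ℂ-algebra, w ∈ ℂ∖{0}, ε' ∈ {1,−1}, and ρ ∈ A invertible with ρ(ρ − ρ⁻¹) = ε'w²(ρ − ρ⁻¹). Then the Baxterised element r̃(λ) := w⁻¹ e^{−λ} ρ − w e^{λ} ρ⁻¹ satisfies the unitarity condition r̃(λ)·r̃(−λ) = (w e^{λ} − w⁻¹ e^{−λ})(w e^{−λ} − w⁻¹ e^{λ})·1 = (w² + w⁻² − e^{2λ} − e^{−2λ})·1 for all λ ∈ ℂ. -/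
/-- If `ρ - ρ⁻¹` is killed by `ρ - c`, then `ρ² - 1 = c² (1 - ρ⁻²)`. -/
theorem mul_self_sub_one_of_mul_sub_inv {R A : Type*} [CommRing R] [Ring A] [Algebra R A]
    {c : R} {ρ ρi : A} (hr : ρ * ρi = 1) (hr' : ρi * ρ = 1)
    (h : ρ * (ρ - ρi) = c • (ρ - ρi)) :
    ρ * ρ - 1 = c ^ 2 • (1 - ρi * ρi) := by
  have h₁ : ρ - ρi = c • (1 - ρi * ρi) := by
    calc ρ - ρi = ρi * (ρ * (ρ - ρi)) := by rw [← mul_assoc, hr', one_mul]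
      _ = c • (1 - ρi * ρi) := by rw [h, mul_smul_comm, mul_sub, hr']
  rw [← hr, ← mul_sub, h, hr, h₁, smul_smul, sq]

/-- The product of two linear combinations of `ρ` and `ρ⁻¹`. -/
theorem smul_sub_smul_mul_smul_sub_smul {R A : Type*} [CommRing R] [Ring A] [Algebra R A]
    {ρ ρi : A} (hr : ρ * ρi = 1) (hr' : ρi * ρ = 1) (a b a' b' : R) :
    (a • ρ - b • ρi) * (a' • ρ - b' • ρi) =
      (a * a') • (ρ * ρ) + (b * b') • (ρi * ρi) - (a * b' + b * a') • (1 : A) := by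
  simp only [sub_mul, mul_sub, smul_mul_smul_comm, hr, hr']
  module

/-- unitarity of the Baxterised element
`r̃(λ) = w⁻¹e^{−λ}ρ − we^λρ⁻¹` of `N_N(w,±,q)`. -/
theorem statement17 (A : Type*) [Ring A] [Algebra ℂ A] (w : ℂ) (hw : w ≠ 0)
    (ε' : ℂ) (hε' : ε' = 1 ∨ ε' = -1)
    (ρ ρi : A) (hr : ρ * ρi = 1) (hr' : ρi * ρ = 1)
    (hrho : ρ * (ρ - ρi) = (ε' * w ^ 2) • (ρ - ρi)) (l : ℂ) :
    ((w⁻¹ * Complex.exp (-l)) • ρ - (w * Complex.exp l) • ρi) *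
        ((w⁻¹ * Complex.exp l) • ρ - (w * Complex.exp (-l)) • ρi) =
      ((w * Complex.exp l - w⁻¹ * Complex.exp (-l)) *
          (w * Complex.exp (-l) - w⁻¹ * Complex.exp l)) • (1 : A) ∧
    ((w⁻¹ * Complex.exp (-l)) • ρ - (w * Complex.exp l) • ρi) *
        ((w⁻¹ * Complex.exp l) • ρ - (w * Complex.exp (-l)) • ρi) =
      (w ^ 2 + (w⁻¹) ^ 2 - Complex.exp (2 * l) - Complex.exp (-(2 * l))) • (1 : A) := by
  have hexp : Complex.exp l * Complex.exp (-l) = 1 := by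
    rw [← Complex.exp_add, add_neg_cancel, Complex.exp_zero]
  have hexp₂ : Complex.exp (2 * l) = Complex.exp l ^ 2 := by
    rw [← Complex.exp_nat_mul, Nat.cast_ofNat]
  have hexp₂' : Complex.exp (-(2 * l)) = Complex.exp (-l) ^ 2 := by
    rw [← Complex.exp_nat_mul, Nat.cast_ofNat, mul_neg]
  have hww : w * w⁻¹ = 1 := mul_inv_cancel₀ hw
  have hε : ε' ^ 2 = 1 := by rcases hε' with rfl | rfl <;> norm_num
  have hsq : ρ * ρ = (1 : A) + w ^ 4 • (1 - ρi * ρi) := by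
    have h := mul_self_sub_one_of_mul_sub_inv hr hr' hrho
    rw [mul_pow, hε, one_mul, ← pow_mul] at h
    rw [← h, add_sub_cancel]
  have hscalar : (w * Complex.exp l - w⁻¹ * Complex.exp (-l)) *
      (w * Complex.exp (-l) - w⁻¹ * Complex.exp l) =
      w ^ 2 + (w⁻¹) ^ 2 - Complex.exp (2 * l) - Complex.exp (-(2 * l)) := by
    rw [hexp₂, hexp₂']
    linear_combination (w ^ 2 + (w⁻¹) ^ 2) * hexp -
      (Complex.exp l ^ 2 + Complex.exp (-l) ^ 2) * hww
  rw [hscalar, and_self, smul_sub_smul_mul_smul_sub_smul hr hr', hsq, hexp₂, hexp₂']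
  have ha : w⁻¹ * Complex.exp (-l) * (w⁻¹ * Complex.exp l) = (w⁻¹) ^ 2 := by
    linear_combination (w⁻¹) ^ 2 * hexp
  have hb : w * Complex.exp l * (w * Complex.exp (-l)) = w ^ 2 := by
    linear_combination w ^ 2 * hexp
  have hc : w⁻¹ * Complex.exp (-l) * (w * Complex.exp (-l)) +
      w * Complex.exp l * (w⁻¹ * Complex.exp l) =
      Complex.exp l ^ 2 + Complex.exp (-l) ^ 2 := by
    linear_combination (Complex.exp l ^ 2 + Complex.exp (-l) ^ 2) * hww
  have hd : (w⁻¹) ^ 2 * w ^ 4 = w ^ 2 := by field_simp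
  rw [ha, hb, hc, smul_add, smul_smul, hd]
  module
end

section
/- Let A be an associative unital ℂ-algebra, w ∈ ℂ∖{0} with a fixed square root w^{1/2}, η ∈ {1,−1}, and b ∈ A invertible satisfying the quotient relation (b + i·w⁻¹)(b + b⁻¹) = 0 of N¹_N(w,−,q). Then the Baxterised boundary element k(λ) := e^λ w^{1/2} b + η e^{−λ} w^{−1/2} b⁻¹ satisfies k(λ)·k(−λ) = (η e^{2λ} + η e^{−2λ} − w − w⁻¹)·1 for all λ ∈ ℂ. -/
/-- In the quotient algebra the even part of the squared boundary generator is scalar. -/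
theorem smul_sq_add_smul_inv_sq {A : Type*} [Ring A] [Algebra ℂ A] {w : ℂ} (hw : w ≠ 0)
    {b bi : A} (hb : b * bi = 1) (hb' : bi * b = 1)
    (hquot : (b + (Complex.I * w⁻¹) • (1 : A)) * (b + bi) = 0) :
    w • (b * b) + w⁻¹ • (bi * bi) = (-w - w⁻¹) • (1 : A) := by
  have hbs : b * (b + bi) = -(Complex.I * w⁻¹) • (b + bi) := by
    rw [add_mul, smul_mul_assoc, one_mul] at hquot
    rw [neg_smul]
    exact eq_neg_of_add_eq_zero_left hquot
  have hs : b + bi = -(Complex.I * w⁻¹) • (bi * (b + bi)) := by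
    rw [← mul_smul_comm, ← hbs, ← mul_assoc, hb', one_mul]
  have hcoef : w * (-(Complex.I * w⁻¹) * -(Complex.I * w⁻¹)) + w⁻¹ = 0 := by
    field_simp
    simp [Complex.I_sq]
  have hsum : w • (b * (b + bi)) + w⁻¹ • (bi * (b + bi)) = 0 := by
    have h : b * (b + bi) =
        (-(Complex.I * w⁻¹) * -(Complex.I * w⁻¹)) • (bi * (b + bi)) := by
      rw [mul_smul, ← hs, hbs]
    rw [h, smul_smul, ← add_smul, hcoef, zero_smul]
  rw [mul_add, mul_add, hb, hb'] at hsum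
  rw [← sub_eq_zero, ← hsum]
  module

/-- unitarity of the Baxterised boundary element
`k(λ) = e^λ w^{1/2} b + η e^{−λ} w^{−1/2} b⁻¹` in `N¹_N(w,−,q)`. -/
theorem statement18 (A : Type*) [Ring A] [Algebra ℂ A]
    (w ws : ℂ) (hw : w ≠ 0) (hws : ws ^ 2 = w) (η : ℂ) (hη : η = 1 ∨ η = -1)
    (b bi : A) (hb : b * bi = 1) (hb' : bi * b = 1)
    (hquot : (b + (Complex.I * w⁻¹) • (1 : A)) * (b + bi) = 0) (l : ℂ) :
    ((Complex.exp l * ws) • b + (η * Complex.exp (-l) * ws⁻¹) • bi) *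
        ((Complex.exp (-l) * ws) • b + (η * Complex.exp l * ws⁻¹) • bi) =
      (η * Complex.exp (2 * l) + η * Complex.exp (-(2 * l)) - w - w⁻¹) • (1 : A) := by
  have hsq := smul_sq_add_smul_inv_sq hw hb hb' hquot
  have hws0 : ws ≠ 0 := by
    rintro rfl
    exact hw (by simpa using hws.symm)
  have hη2 : η * η = 1 := by rcases hη with rfl | rfl <;> norm_num
  have hexp : Complex.exp l * Complex.exp (-l) = 1 := by
    rw [← Complex.exp_add, add_neg_cancel, Complex.exp_zero]
  have hpos : Complex.exp (2 * l) = Complex.exp l * Complex.exp l := by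
    rw [← Complex.exp_add, two_mul]
  have hneg : Complex.exp (-(2 * l)) = Complex.exp (-l) * Complex.exp (-l) := by
    rw [← Complex.exp_add, two_mul, neg_add]
  have hinv : ws * ws⁻¹ = 1 := mul_inv_cancel₀ hws0
  have hbb : (Complex.exp l * ws) * (Complex.exp (-l) * ws) = w := by
    linear_combination ws ^ 2 * hexp + hws
  have hbbi : (Complex.exp l * ws) * (η * Complex.exp l * ws⁻¹) = η * Complex.exp (2 * l) := by
    rw [hpos]
    linear_combination η * Complex.exp l * Complex.exp l * hinv
  have hbib : (η * Complex.exp (-l) * ws⁻¹) * (Complex.exp (-l) * ws) =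
      η * Complex.exp (-(2 * l)) := by
    rw [hneg]
    linear_combination η * Complex.exp (-l) * Complex.exp (-l) * hinv
  have hbibi : (η * Complex.exp (-l) * ws⁻¹) * (η * Complex.exp l * ws⁻¹) = w⁻¹ := by
    rw [← hws, ← inv_pow]
    linear_combination ws⁻¹ ^ 2 * (Complex.exp l * Complex.exp (-l) * hη2 + hexp)
  rw [add_mul, mul_add, mul_add]
  simp only [smul_mul_smul_comm, hbb, hbbi, hbib, hbibi, hb, hb']
  rw [← sub_eq_zero] at hsq ⊢
  rw [← hsq]
  module
end

section
/- (Core identity for the quantum Brauer duality, Proposition on centralizers.) Let A be an associative unital ℂ-algebra and let σ₁, σ₂, ρ₁, ρ₂, b₁ ∈ A be invertible elements satisfying: σ₂b₁ = b₁σ₂ and ρ₂b₁ = b₁ρ₂; σ₂ρ₁ρ₂ = ρ₁ρ₂σ₁; σ₁ρ₂ρ₁ = ρ₂ρ₁σ₂; σ₂ρ₁⁻¹ρ₂ = ρ₁ρ₂⁻¹σ₁; σ₁ρ₂⁻¹ρ₁ = ρ₂ρ₁⁻¹σ₂; σ₁b₁ρ₁⁻¹b₁ = b₁ρ₁⁻¹b₁σ₁;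 and ρ₁b₁σ₁b₁ = b₁σ₁b₁ρ₁. Then b₁⁻¹ρ₁b₁ · (σ₂σ₁ b₁ ρ₁⁻¹ ρ₂⁻¹) = (ρ₂⁻¹ ρ₁⁻¹ b₁ σ₁ σ₂) · b₁⁻¹ρ₁b₁. -/
/-- The local exchange identity holds in any group whose elements `s`, `t`, `r`, `p`, `b` satisfy the
braid-type and reflection relations. -/
theorem conj_exchange_of_braid_of_reflection {G : Type*} [Group G] {s t r p b : G}
    (htb : t * b = b * t) (hpb : p * b = b * p)
    (hm1 : t * r * p = r * p * s) (hm2 : s * p * r = p * r * t)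
    (hm4 : s * p⁻¹ * r = p * r⁻¹ * t)
    (hb1 : s * b * r⁻¹ * b = b * r⁻¹ * b * s)
    (hb2 : r * b * s * b = b * s * b * r) :
    (b⁻¹ * r * b) * (t * s * b * r⁻¹ * p⁻¹) = (p⁻¹ * r⁻¹ * b * s * t) * (b⁻¹ * r * b) := by
  have ht : t = r * p⁻¹ * s * p⁻¹ * r := by
    calc t = r * p⁻¹ * (p * r⁻¹ * t) := by group
      _ = _ := by rw [← hm4]; group
  have htr : t = r * p * s * p⁻¹ * r⁻¹ := by
    calc t = t * r * p * p⁻¹ * r⁻¹ := by group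
      _ = _ := by rw [hm1]
  have htl : t = r⁻¹ * p⁻¹ * s * p * r := by
    calc t = r⁻¹ * p⁻¹ * (p * r * t) := by group
      _ = _ := by rw [← hm2]; group
  have hps : p * p * r⁻¹ * t = r⁻¹ * t * r * r := by
    calc p * p * r⁻¹ * t = p * s * p⁻¹ * r := by rw [ht]; group
      _ = r⁻¹ * (r * p * s * p⁻¹ * r⁻¹) * r * r := by group
      _ = _ := by rw [← htr]
  have hsp : r * r * p⁻¹ * s = p⁻¹ * s * p * p := by
    calc r * r * p⁻¹ * s = r * (r * p⁻¹ * s * p⁻¹ * r) * r⁻¹ * p := by group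
      _ = r * (r⁻¹ * p⁻¹ * s * p * r) * r⁻¹ * p := by rw [← ht, htl]
      _ = _ := by group
  have hpb' : p⁻¹ * b = b * p⁻¹ := Commute.inv_left hpb
  have htb' : t * b⁻¹ = b⁻¹ * t := Commute.inv_right htb
  have hpb'' : p⁻¹ * b⁻¹ = b⁻¹ * p⁻¹ := Commute.inv_inv hpb
  have hrs : r⁻¹ * b * s * b⁻¹ = b⁻¹ * s * b * r⁻¹ := by
    calc r⁻¹ * b * s * b⁻¹ = b⁻¹ * (b * r⁻¹ * b * s) * b⁻¹ := by group
      _ = _ := by rw [← hb1]; group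
  calc (b⁻¹ * r * b) * (t * s * b * r⁻¹ * p⁻¹)
      = b⁻¹ * r * (b * t) * s * b * r⁻¹ * p⁻¹ := by group
    _ = b⁻¹ * r * t * r⁻¹ * (r * b * s * b) * r⁻¹ * p⁻¹ := by rw [← htb]; group
    _ = b⁻¹ * r * t * r⁻¹ * b * s * (b * p⁻¹) := by rw [hb2]; group
    _ = b⁻¹ * r * t * r⁻¹ * b * (s * p⁻¹ * r) * r⁻¹ * b := by rw [← hpb']; group
    _ = b⁻¹ * r * t * r⁻¹ * (b * p) * r⁻¹ * t * r⁻¹ * b := by rw [hm4]; group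
    _ = b⁻¹ * r * t * r⁻¹ * p * b * r⁻¹ * t * r⁻¹ * b := by rw [← hpb]; group
    _ = b⁻¹ * r * (r * p⁻¹ * s * p⁻¹ * r) * r⁻¹ * p * b * r⁻¹ * t * r⁻¹ * b := by rw [← ht]
    _ = b⁻¹ * (r * r * p⁻¹ * s) * b * r⁻¹ * t * r⁻¹ * b := by group
    _ = b⁻¹ * p⁻¹ * s * p * (p * b) * r⁻¹ * t * r⁻¹ * b := by rw [hsp]; group
    _ = b⁻¹ * p⁻¹ * s * p * b * p * r⁻¹ * t * r⁻¹ * b := by rw [hpb]; group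
    _ = b⁻¹ * p⁻¹ * s * (p * b) * p * r⁻¹ * t * r⁻¹ * b := by group
    _ = b⁻¹ * p⁻¹ * s * b * (p * p * r⁻¹ * t) * r⁻¹ * b := by rw [hpb]; group
    _ = (b⁻¹ * p⁻¹) * s * b * r⁻¹ * t * r * b := by rw [hps]; group
    _ = p⁻¹ * (b⁻¹ * s * b * r⁻¹) * t * r * b := by rw [← hpb'']; group
    _ = p⁻¹ * r⁻¹ * b * s * (b⁻¹ * t) * r * b := by rw [← hrs]; group
    _ = (p⁻¹ * r⁻¹ * b * s * t) * (b⁻¹ * r * b) := by rw [← htb']; group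


/-- core identity for the quantum Brauer duality: in `N_N(w,±,q)` the
conjugated element `b₁⁻¹ρ₁b₁` satisfies the local exchange identity
`b₁⁻¹ρ₁b₁ · (σ₂σ₁ b₁ ρ₁⁻¹ρ₂⁻¹) = (ρ₂⁻¹ρ₁⁻¹ b₁ σ₁σ₂) · b₁⁻¹ρ₁b₁`. -/
theorem statement19 (A : Type*) [Ring A] [Algebra ℂ A]
    (σ₁ σ₂ ρ₁ ρ₂ b₁ σ₁i σ₂i ρ₁i ρ₂i b₁i : A)
    (hs1 : σ₁ * σ₁i = 1) (hs1' : σ₁i * σ₁ = 1)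
    (hs2 : σ₂ * σ₂i = 1) (hs2' : σ₂i * σ₂ = 1)
    (hr1 : ρ₁ * ρ₁i = 1) (hr1' : ρ₁i * ρ₁ = 1)
    (hr2 : ρ₂ * ρ₂i = 1) (hr2' : ρ₂i * ρ₂ = 1)
    (hbinv : b₁ * b₁i = 1) (hbinv' : b₁i * b₁ = 1)
    (hc1 : σ₂ * b₁ = b₁ * σ₂) (hc2 : ρ₂ * b₁ = b₁ * ρ₂)
    (hm1 : σ₂ * ρ₁ * ρ₂ = ρ₁ * ρ₂ * σ₁) (hm2 : σ₁ * ρ₂ * ρ₁ = ρ₂ * ρ₁ * σ₂)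
    (hm3 : σ₂ * ρ₁i * ρ₂ = ρ₁ * ρ₂i * σ₁) (hm4 : σ₁ * ρ₂i * ρ₁ = ρ₂ * ρ₁i * σ₂)
    (hb1 : σ₁ * b₁ * ρ₁i * b₁ = b₁ * ρ₁i * b₁ * σ₁)
    (hb2 : ρ₁ * b₁ * σ₁ * b₁ = b₁ * σ₁ * b₁ * ρ₁) :
    (b₁i * ρ₁ * b₁) * (σ₂ * σ₁ * b₁ * ρ₁i * ρ₂i) =
      (ρ₂i * ρ₁i * b₁ * σ₁ * σ₂) * (b₁i * ρ₁ * b₁) := by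
  exact congrArg Units.val (conj_exchange_of_braid_of_reflection
    (s := ⟨σ₁, σ₁i, hs1, hs1'⟩) (t := ⟨σ₂, σ₂i, hs2, hs2'⟩) (r := ⟨ρ₁, ρ₁i, hr1, hr1'⟩)
    (p := ⟨ρ₂, ρ₂i, hr2, hr2'⟩) (b := ⟨b₁, b₁i, hbinv, hbinv'⟩)
    (Units.ext hc1) (Units.ext hc2) (Units.ext hm1) (Units.ext hm2) (Units.ext hm4)
    (Units.ext hb1) (Units.ext hb2))
end
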